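/- arXiv:2604.26749 — 7 statements merged into one kernel-verified Lean document; each statement's English description precedes it below -/
import Mathlib

section
/- Let P ⊆ ℝ² and let V ⊆ ℝ² be a finite set, and let C ⊆ P be a closed convex set. Then C is fully visible (with respect to open-visibility determined by P and V) if and only if every point of V that lies in C is an extreme point of C. -/
/-- Open-visibility: two points `a ≠ b` see each other if the open segment
between them is contained in the polygonal domain `P` and contains no vertex of `V`. -/
def Sees (P V : Set (ℝ × ℝ)) (a b : ℝ × ℝ) : Prop :=
  a ≠ b ∧ openSegment ℝ a b ⊆ P ∧ ∀ v ∈ V, v ∉ openSegment ℝ a b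

/-- A region `C` is fully visible if any two distinct points of `C` see each other. -/
def FullyVisible (P V : Set (ℝ × ℝ)) (C : Set (ℝ × ℝ)) : Prop :=
  ∀ a ∈ C, ∀ b ∈ C, a ≠ b → Sees P V a b

theorem stmt_1 (P V : Set (ℝ × ℝ)) (hV : V.Finite)
    (C : Set (ℝ × ℝ)) (hCP : C ⊆ P)
    (hclosed : IsClosed C) (hconv : Convex ℝ C) :
    FullyVisible P V C ↔
      ∀ v ∈ V, v ∈ C →
        ∀ x₁ ∈ C, ∀ x₂ ∈ C, v ∈ openSegment ℝ x₁ x₂ → x₁ = v ∧ x₂ = v := by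
  constructor
  · intro h v hvV _ x₁ hx₁ x₂ hx₂ hv
    by_cases hne : x₁ = x₂
    · subst hne
      rw [openSegment_same, Set.mem_singleton_iff] at hv
      exact ⟨hv.symm, hv.symm⟩
    · exact absurd hv ((h x₁ hx₁ x₂ hx₂ hne).2.2 v hvV)
  · intro h a ha b hb hab
    have hsub : openSegment ℝ a b ⊆ C := hconv.openSegment_subset ha hb
    refine ⟨hab, hsub.trans hCP, fun v hvV hv ↦ ?_⟩
    obtain ⟨hav, hbv⟩ := h v hvV (hsub hv) a ha b hb hv
    exact hab (hav.trans hbv.symm)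
end

section
/- Let P ⊆ ℝ² and let V ⊆ ℝ² be a finite set. Suppose C₁, …, C_k ⊆ P are fully visible regions whose union covers P, and let B ⊆ P be a set of exactly k pairwise mutually non-visible points. Let p ∈ C₁ be vision minimal in C₁, i.e., Vis(p) ⊆ Vis(q) for every q ∈ C₁. Then there exists q ∈ B ∩ C₁ such that the set B' = (B \ {q}) ∪ {p} is contained in P, has exactly k elements, and its points are pairwise mutually non-visible. -/
/-- The visibility region of a point `a`: itself together with all points of `P`
that it sees. -/
def Vis (P V : Set (ℝ × ℝ)) (a : ℝ × ℝ) : Set (ℝ × ℝ) :=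
  {a} ∪ {b ∈ P | Sees P V a b}

theorem Sees.symm {P V : Set (ℝ × ℝ)} {a b : ℝ × ℝ} (h : Sees P V a b) : Sees P V b a := by
  obtain ⟨hne, hP, hV⟩ := h
  rw [openSegment_symm] at hP hV
  exact ⟨hne.symm, hP, hV⟩

/-- If `k` fully visible regions cover a set of `k` pairwise mutually non-visible points,
then every region contains one of these points. -/
theorem exists_mem_inter_of_fullyVisible_cover {P V : Set (ℝ × ℝ)} {k : ℕ}
    {C : Fin k → Set (ℝ × ℝ)} (hfv : ∀ i, FullyVisible P V (C i))
    {B : Set (ℝ × ℝ)} (hcover : B ⊆ ⋃ i, C i) (hBfin : B.Finite) (hBcard : B.ncard = k)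
    (hB : ∀ a ∈ B, ∀ b ∈ B, a ≠ b → ¬ Sees P V a b) (i : Fin k) :
    ∃ q, q ∈ B ∩ C i := by
  have hmem : ∀ b : B, ∃ j, (b : ℝ × ℝ) ∈ C j := fun b => Set.mem_iUnion.1 (hcover b.2)
  choose f hf using hmem
  have hinj : Function.Injective f := by
    intro a b hab
    by_contra hne
    have hne' : (a : ℝ × ℝ) ≠ b := fun h => hne (Subtype.ext h)
    exact hB a a.2 b b.2 hne' (hfv (f a) a (hf a) b (hab ▸ hf b) hne')
  have : Finite B := hBfin
  have hcard : Nat.card (Fin k) ≤ Nat.card B := by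
    rw [Nat.card_fin, Nat.card_coe_set_eq, hBcard]
  obtain ⟨q, rfl⟩ := (hinj.bijective_of_nat_card_le hcard).surjective i
  exact ⟨q, q.2, hf q⟩

theorem stmt_2 (P V : Set (ℝ × ℝ)) (hV : V.Finite)
    (k : ℕ) (hk : 0 < k) (C : Fin k → Set (ℝ × ℝ))
    (hCP : ∀ i, C i ⊆ P)
    (hfv : ∀ i, FullyVisible P V (C i))
    (hcover : P ⊆ ⋃ i, C i)
    (B : Set (ℝ × ℝ)) (hBP : B ⊆ P) (hBfin : B.Finite) (hBcard : B.ncard = k)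
    (hB : ∀ a ∈ B, ∀ b ∈ B, a ≠ b → ¬ Sees P V a b)
    (p : ℝ × ℝ) (hp : p ∈ C ⟨0, hk⟩)
    (hmin : ∀ q ∈ C ⟨0, hk⟩, Vis P V p ⊆ Vis P V q) :
    ∃ q ∈ B ∩ C ⟨0, hk⟩,
      insert p (B \ {q}) ⊆ P ∧
      (insert p (B \ {q})).ncard = k ∧
      ∀ a ∈ insert p (B \ {q}), ∀ b ∈ insert p (B \ {q}), a ≠ b → ¬ Sees P V a b := by
  obtain ⟨q, hqB, hqC⟩ :=
    exists_mem_inter_of_fullyVisible_cover hfv (hBP.trans hcover) hBfin hBcard hB ⟨0, hk⟩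
  have hpB : p ∉ B \ {q} := fun ⟨hpB, hpq⟩ => hB p hpB q hqB hpq (hfv _ p hp q hqC hpq)
  have hpsees : ∀ b ∈ B \ {q}, ¬ Sees P V p b := by
    rintro b ⟨hbB, hbq⟩ hpb
    rcases hmin q hqC (Or.inr ⟨hBP hbB, hpb⟩) with h | ⟨-, h⟩
    · exact hbq h
    · exact hB q hqB b hbB (Ne.symm hbq) h
  refine ⟨q, ⟨hqB, hqC⟩, Set.insert_subset (hCP _ hp) (Set.sdiff_subset.trans hBP), ?_, ?_⟩
  · rw [Set.ncard_insert_of_notMem hpB hBfin.sdiff, Set.ncard_sdiff_singleton_add_one hqB hBfin,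
      hBcard]
  · rintro a (rfl | ha) b (rfl | hb) hab
    · exact absurd rfl hab
    · exact hpsees b hb
    · exact fun h => hpsees a ha h.symm
    · exact hB a ha.1 b hb.1 hab
end

section
/- Let P ⊆ ℝ² and let V ⊆ ℝ² be a finite set. Let p, p' ∈ P be two distinct points that do not see each other, and suppose there are two fully visible regions C₁, C₂ ⊆ P with Vis(p) ∪ Vis(p') = C₁ ∪ C₂. Then for all q, q' ∈ Vis(p) ∪ Vis(p') with q ≠ q' such that q and q' do not see each other, one has Vis(p) ∪ Vis(p') ⊆ Vis(q) ∪ Vis(q'). -/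
/-- A fully visible region of `P` lies in the visibility region of each of its points. -/
theorem FullyVisible.subset_vis {P V C : Set (ℝ × ℝ)} (h : FullyVisible P V C) (hC : C ⊆ P)
    {a : ℝ × ℝ} (ha : a ∈ C) : C ⊆ Vis P V a := by
  intro x hx
  by_cases hax : a = x
  · exact Or.inl hax.symm
  · exact Or.inr ⟨hC hx, h a ha x hx hax⟩

theorem stmt_3 (P V : Set (ℝ × ℝ)) (hV : V.Finite)
    (p p' : ℝ × ℝ) (hp : p ∈ P) (hp' : p' ∈ P) (hne : p ≠ p')
    (hnosee : ¬ Sees P V p p')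
    (C₁ C₂ : Set (ℝ × ℝ)) (hC₁ : C₁ ⊆ P) (hC₂ : C₂ ⊆ P)
    (hfv₁ : FullyVisible P V C₁) (hfv₂ : FullyVisible P V C₂)
    (hcov : Vis P V p ∪ Vis P V p' = C₁ ∪ C₂) :
    ∀ q ∈ Vis P V p ∪ Vis P V p', ∀ q' ∈ Vis P V p ∪ Vis P V p',
      q ≠ q' → ¬ Sees P V q q' →
        Vis P V p ∪ Vis P V p' ⊆ Vis P V q ∪ Vis P V q' := by
  rw [hcov]
  rintro q (hq | hq) q' (hq' | hq') hqq' hns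
  · exact absurd (hfv₁ q hq q' hq' hqq') hns
  · exact Set.union_subset_union (hfv₁.subset_vis hC₁ hq) (hfv₂.subset_vis hC₂ hq')
  · rw [Set.union_comm (Vis P V q)]
    exact Set.union_subset_union (hfv₁.subset_vis hC₁ hq') (hfv₂.subset_vis hC₂ hq)
  · exact absurd (hfv₂ q hq q' hq' hqq') hns
end

section
/- Let P ⊆ ℝ² and let V ⊆ ℝ² be a finite set. Let B ⊆ P be a set of pairwise mutually non-visible points, let Q ⊆ B, and let S ⊆ P be a set of pairwise mutually non-visible points such that the union of the visibility regions of the points of S is contained in the union of the visibility regions of the points of Q, i.e., ⋃_{s ∈ S} Vis(s) ⊆ ⋃_{q ∈ Q} Vis(q). Then the set B' = (B \ Q) ∪ S also consists of pairwise mutually non-visible points. -/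
/-- A point of `B \ Q` lies in no visibility region of a point of `Q`, hence is not seen
from `S`. -/
theorem not_sees_of_iUnion_vis_subset {P V B Q S : Set (ℝ × ℝ)} (hBP : B ⊆ P) (hQB : Q ⊆ B)
    (hB : ∀ a ∈ B, ∀ b ∈ B, a ≠ b → ¬ Sees P V a b)
    (hsub : (⋃ s ∈ S, Vis P V s) ⊆ ⋃ q ∈ Q, Vis P V q)
    {s b : ℝ × ℝ} (hs : s ∈ S) (hb : b ∈ B \ Q) : ¬ Sees P V s b := by
  intro h
  have hmem : b ∈ ⋃ q ∈ Q, Vis P V q :=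
    hsub (Set.mem_biUnion hs (Or.inr ⟨hBP hb.1, h⟩))
  obtain ⟨q, hq, rfl | ⟨-, hqb⟩⟩ := Set.mem_iUnion₂.mp hmem
  · exact hb.2 hq
  · exact hB q (hQB hq) b hb.1 hqb.1 hqb

theorem stmt_4 (P V : Set (ℝ × ℝ)) (hV : V.Finite)
    (B Q S : Set (ℝ × ℝ)) (hBP : B ⊆ P) (hQB : Q ⊆ B) (hSP : S ⊆ P)
    (hB : ∀ a ∈ B, ∀ b ∈ B, a ≠ b → ¬ Sees P V a b)
    (hS : ∀ a ∈ S, ∀ b ∈ S, a ≠ b → ¬ Sees P V a b)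
    (hsub : (⋃ s ∈ S, Vis P V s) ⊆ ⋃ q ∈ Q, Vis P V q) :
    ∀ a ∈ (B \ Q) ∪ S, ∀ b ∈ (B \ Q) ∪ S, a ≠ b → ¬ Sees P V a b := by
  rintro a (ha | ha) b (hb | hb) hab
  · exact hB a ha.1 b hb.1 hab
  · exact fun h => not_sees_of_iUnion_vis_subset hBP hQB hB hsub hb ha h.symm
  · exact not_sees_of_iUnion_vis_subset hBP hQB hB hsub ha hb
  · exact hS a ha b hb hab
end

section
/- Let h ∈ ℝ with h ≠ 0, and let p = (p₁, h) and q = (q₁, h) be two pivot points at the same height h. Let X₋ ≠ X₊ and Y₋, Y₊ be real numbers, and let s, t, r ∈ ℝ² with s ≠ t be points such that: s is collinear with (X₋, 0) and p, and collinear with (Y₋, 0) and q; t is collinear with (X₊, 0) and p, and collinear with (Y₊, 0) and q; neither p nor q lies on the line through s and t. Suppose X, Y ∈ ℝ are such that r is collinear with (X, 0) and p, collinear with (Y, 0) and q, and collinear with s and t. Then (X − X₋)·(Y₊ − Y₋) = (Y − Y₋)·(X₊ − X₋). -/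
/-- The central projection from `(p, h)` onto the first axis sends `u` to `(X, 0)` only if
`(X - p) * (h - u.2) = (u.1 - p) * h`. -/
theorem Collinear.sub_mul_sub_eq {h p X : ℝ} {u : ℝ × ℝ}
    (hu : Collinear ℝ {u, ((X, 0) : ℝ × ℝ), (p, h)}) :
    (X - p) * (h - u.2) = (u.1 - p) * h := by
  obtain ⟨v, hv⟩ := (collinear_iff_of_mem (p₀ := ((p, h) : ℝ × ℝ)) (by simp)).1 hu
  obtain ⟨a, ha⟩ := hv u (by simp)
  obtain ⟨b, hb⟩ := hv (X, 0) (by simp)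
  simp only [vadd_eq_add, Prod.ext_iff, Prod.fst_add, Prod.snd_add, Prod.smul_fst, Prod.smul_snd,
    smul_eq_mul] at ha hb
  obtain ⟨ha₁, ha₂⟩ := ha
  obtain ⟨hb₁, hb₂⟩ := hb
  rw [ha₁, ha₂, hb₁]
  linear_combination a * v.1 * hb₂

/-- If `s`, `t` and `AffineMap.lineMap s t c` project from `(p, h)` to `(A, 0)`, `(B, 0)` and
`(X, 0)`, then the position of `X` relative to `A` and `B` does not depend on `p`. -/
theorem sub_mul_sub_lineMap_eq {h p A B X c : ℝ} {s t : ℝ × ℝ}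
    (hs : Collinear ℝ {s, ((A, 0) : ℝ × ℝ), (p, h)})
    (ht : Collinear ℝ {t, ((B, 0) : ℝ × ℝ), (p, h)})
    (hr : Collinear ℝ {AffineMap.lineMap s t c, ((X, 0) : ℝ × ℝ), (p, h)}) :
    (X - A) * (h - (AffineMap.lineMap s t c).2) = c * (h - t.2) * (B - A) := by
  have hs' := hs.sub_mul_sub_eq
  have ht' := ht.sub_mul_sub_eq
  have hr' := hr.sub_mul_sub_eq
  simp only [AffineMap.lineMap_apply, vsub_eq_sub, vadd_eq_add, Prod.fst_add, Prod.snd_add,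
    Prod.smul_fst, Prod.smul_snd, Prod.fst_sub, Prod.snd_sub, smul_eq_mul] at hr' ⊢
  linear_combination hr' - (1 - c) * hs' - c * ht'

theorem stmt_5 (h : ℝ) (hh : h ≠ 0) (p₁ q₁ : ℝ)
    (Xm Xp Ym Yp X Y : ℝ) (hX : Xm ≠ Xp)
    (s t r : ℝ × ℝ) (hst : s ≠ t)
    (hs1 : Collinear ℝ {s, ((Xm, 0) : ℝ × ℝ), (p₁, h)})
    (hs2 : Collinear ℝ {s, ((Ym, 0) : ℝ × ℝ), (q₁, h)})
    (ht1 : Collinear ℝ {t, ((Xp, 0) : ℝ × ℝ), (p₁, h)})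
    (ht2 : Collinear ℝ {t, ((Yp, 0) : ℝ × ℝ), (q₁, h)})
    (hpst : ¬ Collinear ℝ {s, t, ((p₁, h) : ℝ × ℝ)})
    (hqst : ¬ Collinear ℝ {s, t, ((q₁, h) : ℝ × ℝ)})
    (hr1 : Collinear ℝ {r, ((X, 0) : ℝ × ℝ), (p₁, h)})
    (hr2 : Collinear ℝ {r, ((Y, 0) : ℝ × ℝ), (q₁, h)})
    (hr3 : Collinear ℝ {r, s, t}) :
    (X - Xm) * (Yp - Ym) = (Y - Ym) * (Xp - Xm) := by
  have hr : r ∈ line[ℝ, s, t] :=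
    hr3.mem_affineSpan_of_mem_of_ne (by simp) (by simp) (by simp) hst
  obtain ⟨c, rfl⟩ := mem_affineSpan_pair_iff_exists_lineMap_eq.1 hr
  have hne : h - (AffineMap.lineMap s t c).2 ≠ 0 := by
    intro h0
    have h1 := hr1.sub_mul_sub_eq
    rw [h0, mul_zero, eq_comm, mul_eq_zero, or_iff_left hh] at h1
    have hp : AffineMap.lineMap s t c = ((p₁, h) : ℝ × ℝ) :=
      Prod.ext (sub_eq_zero.1 h1) (sub_eq_zero.1 h0).symm
    rw [hp] at hr3
    apply hpst
    rwa [Set.pair_comm t, Set.insert_comm]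
  have hXr := sub_mul_sub_lineMap_eq hs1 ht1 hr1
  have hYr := sub_mul_sub_lineMap_eq hs2 ht2 hr2
  apply mul_right_cancel₀ hne
  linear_combination (Yp - Ym) * hXr - (Xp - Xm) * hYr
end

section
/- Let x, y, z, C, δ, h ∈ ℝ with h ≠ 0. Consider the three birdhouse points (x, 0), (C + z/2, 0), (2C + y, 0) on the x-axis and the three pivot points (C − δ, h), (C, h), (C + δ, h). Suppose there exists a point t ∈ ℝ² whose second coordinate is neither 0 nor h such that t is collinear with (x, 0) and (C − δ, h), collinear with (C + z/2, 0) and (C, h), and collinear with (2C + y, 0) and (C + δ, h). Then x + y = z. -/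
/-- Collinear points of a coordinate plane have vanishing cross product of differences. -/
theorem Collinear.sub_mul_sub_eq_s7 {K : Type*} [Field K] {p q r : K × K}
    (h : Collinear K {p, q, r}) :
    (p.1 - q.1) * (r.2 - q.2) = (p.2 - q.2) * (r.1 - q.1) := by
  obtain ⟨v, hv⟩ := (collinear_iff_of_mem (p₀ := q) (by simp)).1 h
  obtain ⟨a, rfl⟩ := hv p (by simp)
  obtain ⟨b, rfl⟩ := hv r (by simp)
  simp only [vadd_eq_add, Prod.fst_add, Prod.snd_add, Prod.smul_fst, Prod.smul_snd, smul_eq_mul]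
  ring

theorem stmt_7 (x y z C δ h : ℝ) (hh : h ≠ 0) (t : ℝ × ℝ)
    (ht0 : t.2 ≠ 0) (hth : t.2 ≠ h)
    (h₁ : Collinear ℝ {t, ((x, 0) : ℝ × ℝ), (C - δ, h)})
    (h₂ : Collinear ℝ {t, ((C + z / 2, 0) : ℝ × ℝ), (C, h)})
    (h₃ : Collinear ℝ {t, ((2 * C + y, 0) : ℝ × ℝ), (C + δ, h)}) :
    x + y = z := by
  have e₁ := h₁.sub_mul_sub_eq_s7
  have e₂ := h₂.sub_mul_sub_eq_s7
  have e₃ := h₃.sub_mul_sub_eq_s7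
  dsimp only at e₁ e₂ e₃
  apply mul_right_cancel₀ (sub_ne_zero.2 hth)
  linear_combination e₁ + e₃ - 2 * e₂
end

section
/- Let k, l ∈ ℝ with k ≠ 0, and let ℓ = {(u, v) ∈ ℝ² : v = k·u + l}. Let p = (p₁, p₂) and q = (q₁, q₂) be points of ℝ² with p₂ ≠ 0, q₂ ≠ 0, p₂ ≠ k·p₁ + l, q₂ ≠ k·q₁ + l, and p₂ ≠ q₂. Then there do not exist α, β ∈ ℝ such that for all x, y ∈ ℝ and all r ∈ ℓ with r collinear with (x, 0) and p, and r collinear with q and (y, 0), one has y = α·x + β. -/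
/-- The central projection of `r` onto the horizontal axis through the pivot `p` is collinear with
`r` and `p`. -/
theorem collinear_centralProjection (r p : ℝ × ℝ) (h : p.2 - r.2 ≠ 0) :
    Collinear ℝ {r, (((p.2 * r.1 - r.2 * p.1) / (p.2 - r.2), 0) : ℝ × ℝ), p} := by
  rw [collinear_iff_of_mem (p₀ := r) (by simp)]
  refine ⟨p - r, ?_⟩
  rintro w (rfl | rfl | rfl)
  · exact ⟨0, by simp⟩
  · refine ⟨-r.2 / (p.2 - r.2), ?_⟩
    ext <;> simp <;> field_simp <;> ring
  · exact ⟨1, by simp⟩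

theorem stmt_8 (k l : ℝ) (hk : k ≠ 0) (p q : ℝ × ℝ)
    (hp0 : p.2 ≠ 0) (hq0 : q.2 ≠ 0)
    (hpl : p.2 ≠ k * p.1 + l) (hql : q.2 ≠ k * q.1 + l)
    (hpq : p.2 ≠ q.2) :
    ¬ ∃ α β : ℝ, ∀ x y : ℝ, ∀ r ∈ {w : ℝ × ℝ | w.2 = k * w.1 + l},
      Collinear ℝ {r, ((x, 0) : ℝ × ℝ), p} →
      Collinear ℝ {r, q, ((y, 0) : ℝ × ℝ)} →
      y = α * x + β := by
  rintro ⟨α, β, h⟩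
  have quadratic_eq_zero (v : ℝ) (hp : p.2 - v ≠ 0) (hq : q.2 - v ≠ 0) :
      (q.2 * (v - l) - k * v * q.1) * (p.2 - v) - α * (p.2 * (v - l) - k * v * p.1) * (q.2 - v)
        - k * β * (p.2 - v) * (q.2 - v) = 0 := by
    have hy := collinear_centralProjection ((v - l) / k, v) q hq
    rw [Set.pair_comm] at hy
    have e := h _ _ ((v - l) / k, v) (by simp; field_simp; ring)
      (collinear_centralProjection ((v - l) / k, v) p hp) hy
    simp only at e
    field_simp at e
    linear_combination e
  have hd : p.2 - q.2 ≠ 0 := sub_ne_zero.mpr hpq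
  have off_pivots (n : ℝ) (hn : 0 < n) :=
    quadratic_eq_zero (q.2 - n * (p.2 - q.2))
      (by convert mul_ne_zero (by positivity : n + 1 ≠ 0) hd using 1; ring)
      (by convert mul_ne_zero hn.ne' hd using 1; ring)
  -- A quadratic vanishing at three points vanishes at `q.2`, by third differences.
  have at_pivot : q.2 * (q.2 - l - k * q.1) * (p.2 - q.2) = 0 := by
    linear_combination 3 * off_pivots 1 (by norm_num) - 3 * off_pivots 2 (by norm_num)
      + off_pivots 3 (by norm_num)
  have hql' : q.2 - l - k * q.1 ≠ 0 := fun e => hql (by linear_combination e)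
  exact mul_ne_zero (mul_ne_zero hq0 hql') hd at_pivot
end
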